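/- Let G be a word-hyperbolic group with a finite generating set X. Then G has rational growth with respect to X: the spherical growth series s_{G,X}(t) = Σ_{n≥0} 𝔖(n) tⁿ is a rational function. -/

import Mathlib

/-!
Coornaert's theorem: a non-elementary word-hyperbolic group has purely
exponential growth of balls.
-/

/-- The word length of `g` with respect to a generating set `X`: the least `n` such that
`g` is a product of `n` elements of `X ∪ X⁻¹`. -/
noncomputable def wordLength {G : Type*} [Group G] (X : Set G) (g : G) : ℕ :=
  sInf {n | ∃ w : List G, w.length = n ∧ (∀ x ∈ w, x ∈ X ∨ x⁻¹ ∈ X) ∧ w.prod = g}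

/-- The word metric `d(g,h) = |g⁻¹h|_X`. -/
noncomputable def wordDist {G : Type*} [Group G] (X : Set G) (g h : G) : ℕ :=
  wordLength X (g⁻¹ * h)

/-- `𝔖(n)`, the cardinality of the sphere of radius `n`. -/
noncomputable def sphereCard {G : Type*} [Group G] (X : Set G) (n : ℕ) : ℕ :=
  {g : G | wordLength X g = n}.ncard

/-- `𝔅(n)`, the cardinality of the ball of radius `n`. -/
noncomputable def ballCard {G : Type*} [Group G] (X : Set G) (n : ℕ) : ℕ :=
  {g : G | wordLength X g ≤ n}.ncard

/-- A (discrete) geodesic in the Cayley graph `Γ(G,X)` from `a` to `b`: the sequence of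
vertices visited by a geodesic path, parametrised by arc length. -/
def IsGeodesic {G : Type*} [Group G] (X : Set G) (a b : G) (γ : ℕ → G) : Prop :=
  γ 0 = a ∧ γ (wordDist X a b) = b ∧
    ∀ i j, i ≤ wordDist X a b → j ≤ wordDist X a b →
      wordDist X (γ i) (γ j) = Nat.dist i j

/-- Triangles in the Cayley graph `Γ(G,X)` are `δ`-thin (`δ` a positive integer): every
vertex on one side of a geodesic triangle is at distance at most `δ` from the union of the
other two sides. -/
def TrianglesThin {G : Type*} [Group G] (X : Set G) (δ : ℕ) : Prop :=
  ∀ (a b c : G) (γ₁ γ₂ γ₃ : ℕ → G),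
    IsGeodesic X a b γ₁ → IsGeodesic X b c γ₂ → IsGeodesic X a c γ₃ →
    ∀ i ≤ wordDist X a c, ∃ j,
      (j ≤ wordDist X a b ∧ wordDist X (γ₃ i) (γ₁ j) ≤ δ) ∨
      (j ≤ wordDist X b c ∧ wordDist X (γ₃ i) (γ₂ j) ≤ δ)

/-- A group is virtually cyclic if it has a cyclic subgroup of finite index. -/
def VirtuallyCyclic (G : Type*) [Group G] : Prop :=
  ∃ H : Subgroup G, IsCyclic H ∧ H.FiniteIndex

/-- A formal power series over `ℤ` is rational if `Q·F = P` for some integer polynomials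
`P, Q` with `Q` having nonzero constant term. -/
def PowerSeriesIsRational (F : PowerSeries ℤ) : Prop :=
  ∃ P Q : Polynomial ℤ, Q.coeff 0 ≠ 0 ∧ (Q : PowerSeries ℤ) * F = (P : PowerSeries ℤ)

/-! ### Linear recurrences and rational power series -/

/-- A sequence of integers annihilated by `∑ i, q_i σ ^ (i * L)`, with `σ` the shift and `q ≠ 0`,
has a rational generating series. -/
lemma powerSeriesIsRational_of_recurrence (s : ℕ → ℤ) (L : ℕ) (hL : 0 < L) (q : Polynomial ℤ)
    (hq : q ≠ 0)
    (h : ∀ n, ∑ i ∈ Finset.range (q.natDegree + 1), q.coeff i * s (n + i * L) = 0) :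
    PowerSeriesIsRational (PowerSeries.mk s) := by
  set d := q.natDegree with hd
  let Q : Polynomial ℤ := ∑ i ∈ Finset.range (d + 1),
    Polynomial.C (q.coeff i) * Polynomial.X ^ ((d - i) * L)
  refine ⟨PowerSeries.trunc (d * L) ((Q : PowerSeries ℤ) * PowerSeries.mk s), Q, ?_, ?_⟩
  · have : Q.coeff 0 = q.coeff d := by
      simp only [Q, Polynomial.finsetSum_coeff, Polynomial.coeff_C_mul, Polynomial.coeff_X_pow]
      rw [Finset.sum_eq_single d]
      · simp
      · intro i hi hid
        have : 0 < (d - i) * L := Nat.mul_pos (by simp at hi; omega) hL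
        simp [this.ne]
      · simp
    rw [this]
    exact Polynomial.leadingCoeff_ne_zero.2 hq
  · ext m
    rw [Polynomial.coeff_coe, PowerSeries.coeff_trunc]
    split_ifs with hm
    · rfl
    · push Not at hm
      rw [← h (m - d * L)]
      have hQ : (Q : PowerSeries ℤ) = ∑ i ∈ Finset.range (d + 1),
          PowerSeries.C (q.coeff i) * PowerSeries.X ^ ((d - i) * L) := by
        have := map_sum (Polynomial.coeToPowerSeries.ringHom (R := ℤ))
          (fun i => Polynomial.C (q.coeff i) * Polynomial.X ^ ((d - i) * L)) (Finset.range (d + 1))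
        simpa only [Polynomial.coeToPowerSeries.ringHom_apply, Polynomial.coe_mul, Polynomial.coe_C,
          Polynomial.coe_pow, Polynomial.coe_X] using this
      rw [hQ, Finset.sum_mul, map_sum]
      refine Finset.sum_congr rfl fun i hi => ?_
      have hi' : i ≤ d := by simp at hi; omega
      have hle : (d - i) * L ≤ m := le_trans (Nat.mul_le_mul_right _ (Nat.sub_le _ _)) hm
      have hidx : m - (d - i) * L = m - d * L + i * L := by
        have : d * L = (d - i) * L + i * L := by rw [← Nat.add_mul, Nat.sub_add_cancel hi']
        omega
      rw [mul_assoc, PowerSeries.coeff_C_mul, PowerSeries.coeff_X_pow_mul', if_pos hle,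
        PowerSeries.coeff_mk, hidx]

/-- The sum of the coordinates of a vector-valued sequence satisfying `b (n + L) = A b n` has a
rational generating series. -/
lemma powerSeriesIsRational_of_matrix {τ : Type*} [Fintype τ] [DecidableEq τ]
    (A : Matrix τ τ ℚ) (b : ℕ → τ → ℚ) (s : ℕ → ℤ) (L : ℕ) (hL : 0 < L)
    (hb : ∀ n, b (n + L) = A.mulVec (b n)) (hs : ∀ n, (s n : ℚ) = ∑ l, b n l) :
    PowerSeriesIsRational (PowerSeries.mk s) := by
  obtain ⟨q, hq, hqA⟩ : ∃ q : Polynomial ℤ, q ≠ 0 ∧ Polynomial.aeval A q = 0 := by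
    refine ⟨IsLocalization.integerNormalization (nonZeroDivisors ℤ) A.charpoly,
      fun h => A.charpoly_monic.ne_zero (IsFractionRing.integerNormalization_eq_zero_iff.1 h), ?_⟩
    obtain ⟨c, -, hc⟩ :=
      IsLocalization.integerNormalization_spec (nonZeroDivisors ℤ) A.charpoly
    rw [← Polynomial.aeval_map_algebraMap ℚ, hc, map_zsmul, Matrix.aeval_self_charpoly, smul_zero]
  refine powerSeriesIsRational_of_recurrence s L hL q hq fun n => ?_
  have hpow : ∀ i, b (n + i * L) = (A ^ i).mulVec (b n) := by
    intro i
    induction i with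
    | zero => simp
    | succ i ih =>
      rw [Nat.succ_mul, ← add_assoc, hb, ih, pow_succ', Matrix.mulVec_mulVec]
  have hzero : ∑ i ∈ Finset.range (q.natDegree + 1), (q.coeff i : ℚ) • b (n + i * L) = 0 := by
    rw [Polynomial.aeval_eq_sum_range] at hqA
    have := congrArg (fun M : Matrix τ τ ℚ => M.mulVec (b n)) hqA
    simp only [Matrix.sum_mulVec, Matrix.zero_mulVec] at this
    rw [← this]
    refine Finset.sum_congr rfl fun i _ => ?_
    rw [hpow, ← Matrix.smul_mulVec, Int.cast_smul_eq_zsmul]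
  have : ((∑ i ∈ Finset.range (q.natDegree + 1), q.coeff i * s (n + i * L) : ℤ) : ℚ) = 0 := by
    push_cast
    have h2 := congrArg (fun v : τ → ℚ => ∑ l, v l) hzero
    simp only [Finset.sum_apply, Pi.smul_apply, smul_eq_mul, Pi.zero_apply,
      Finset.sum_const_zero] at h2
    rw [Finset.sum_comm] at h2
    simpa [hs, Finset.mul_sum] using h2
  exact_mod_cast this

/-! ### Word length and geodesics -/

section WordLength

variable {G : Type*} [Group G] {X : Set G}

lemma exists_word_prod_eq (hgen : Subgroup.closure X = ⊤) (g : G) :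
    ∃ w : List G, (∀ x ∈ w, x ∈ X ∨ x⁻¹ ∈ X) ∧ w.prod = g := by
  have hg : g ∈ (Subgroup.closure X).toSubmonoid := by rw [hgen]; trivial
  rw [Subgroup.closure_toSubmonoid] at hg
  simpa using Submonoid.exists_list_of_mem_closure hg

lemma wordLength_prod_le {w : List G} (hw : ∀ x ∈ w, x ∈ X ∨ x⁻¹ ∈ X) :
    wordLength X w.prod ≤ w.length :=
  Nat.sInf_le ⟨w, rfl, hw, rfl⟩

lemma exists_word_length_eq (hgen : Subgroup.closure X = ⊤) (g : G) :
    ∃ w : List G, w.length = wordLength X g ∧ (∀ x ∈ w, x ∈ X ∨ x⁻¹ ∈ X) ∧ w.prod = g := by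
  obtain ⟨w, hw, hg⟩ := exists_word_prod_eq hgen g
  exact Nat.sInf_mem (s := {n | ∃ w : List G, w.length = n ∧ (∀ x ∈ w, x ∈ X ∨ x⁻¹ ∈ X) ∧
    w.prod = g}) ⟨_, w, rfl, hw, hg⟩

lemma wordLength_one : wordLength X (1 : G) = 0 := by
  simpa using wordLength_prod_le (X := X) (w := []) (by simp)

lemma eq_one_of_wordLength_eq_zero (hgen : Subgroup.closure X = ⊤) {g : G}
    (hg : wordLength X g = 0) : g = 1 := by
  obtain ⟨w, hl, -, rfl⟩ := exists_word_length_eq hgen g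
  rw [hg, List.length_eq_zero_iff] at hl
  simp [hl]

lemma wordLength_mul_le (hgen : Subgroup.closure X = ⊤) (g h : G) :
    wordLength X (g * h) ≤ wordLength X g + wordLength X h := by
  obtain ⟨v, hv, hvX, rfl⟩ := exists_word_length_eq hgen g
  obtain ⟨w, hw, hwX, rfl⟩ := exists_word_length_eq hgen h
  rw [← hv, ← hw, ← List.prod_append, ← List.length_append]
  exact wordLength_prod_le fun x hx => (List.mem_append.1 hx).elim (hvX x) (hwX x)

lemma wordLength_inv_le (hgen : Subgroup.closure X = ⊤) (g : G) :
    wordLength X g⁻¹ ≤ wordLength X g := by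
  obtain ⟨v, hv, hvX, rfl⟩ := exists_word_length_eq hgen g
  rw [← hv, List.prod_inv_reverse]
  refine (wordLength_prod_le ?_).trans (by simp)
  intro x hx
  simp only [List.mem_reverse, List.mem_map] at hx
  obtain ⟨y, hy, rfl⟩ := hx
  simpa [or_comm] using hvX y hy

lemma wordLength_inv (hgen : Subgroup.closure X = ⊤) (g : G) :
    wordLength X g⁻¹ = wordLength X g :=
  (wordLength_inv_le hgen g).antisymm (by simpa using wordLength_inv_le hgen g⁻¹)

lemma wordDist_comm (hgen : Subgroup.closure X = ⊤) (g h : G) :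
    wordDist X g h = wordDist X h g := by
  rw [wordDist, wordDist, ← wordLength_inv hgen]
  simp

lemma wordDist_triangle (hgen : Subgroup.closure X = ⊤) (a b c : G) :
    wordDist X a c ≤ wordDist X a b + wordDist X b c := by
  have := wordLength_mul_le hgen (a⁻¹ * b) (b⁻¹ * c)
  simpa [wordDist, mul_assoc] using this

lemma wordDist_self (g : G) : wordDist X g g = 0 := by
  simp [wordDist, wordLength_one]

lemma wordDist_one_left (g : G) : wordDist X 1 g = wordLength X g := by
  simp [wordDist]

lemma wordDist_self_mul (g h : G) : wordDist X g (g * h) = wordLength X h := by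
  simp [wordDist]

/-- A point between `a` and `b` lies on a geodesic from `a` to `b`. -/
lemma exists_isGeodesic_through (hgen : Subgroup.closure X = ⊤) {a p b : G}
    (h : wordDist X a p + wordDist X p b = wordDist X a b) :
    ∃ γ, IsGeodesic X a b γ ∧ γ (wordDist X a p) = p := by
  obtain ⟨v, hv, hvX, hvp⟩ := exists_word_length_eq hgen (a⁻¹ * p)
  obtain ⟨w, hw, hwX, hwp⟩ := exists_word_length_eq hgen (p⁻¹ * b)
  change v.length = wordDist X a p at hv
  change w.length = wordDist X p b at hw
  set u := v ++ w with hu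
  have huX : ∀ x ∈ u, x ∈ X ∨ x⁻¹ ∈ X :=
    fun x hx => (List.mem_append.1 hx).elim (hvX x) (hwX x)
  have hul : u.length = wordDist X a b := by rw [hu, List.length_append, hv, hw, h]
  set γ : ℕ → G := fun i => a * (u.take i).prod with hγ
  have h0 : γ 0 = a := by simp [hγ]
  have hend : γ (wordDist X a b) = b := by
    simp only [hγ, ← hul, List.take_length]
    simp [hu, hvp, hwp]
  have hp : γ (wordDist X a p) = p := by
    simp only [hγ, hu, ← hv, List.take_left, hvp]
    simp
  have hle : ∀ i j, i ≤ j → wordDist X (γ i) (γ j) ≤ j - i := by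
    intro i j hij
    have : (γ i)⁻¹ * γ j = ((u.take j).drop i).prod := by
      have h1 : (u.take j).prod = (u.take i).prod * ((u.take j).drop i).prod := by
        conv_lhs => rw [← List.take_append_drop i (u.take j)]
        rw [List.prod_append, List.take_take, min_eq_left hij]
      simp only [hγ, h1]
      group
    rw [wordDist, this]
    refine (wordLength_prod_le fun x hx =>
      huX x (List.mem_of_mem_take (List.mem_of_mem_drop hx))).trans ?_
    simp only [List.length_drop, List.length_take]
    omega
  have key : ∀ i j, i ≤ j → j ≤ wordDist X a b → wordDist X (γ i) (γ j) = j - i := by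
    intro i j hij hj
    have h1 := hle 0 i (Nat.zero_le _)
    have h2 := hle i j hij
    have h3 := hle j _ hj
    have h4 := wordDist_triangle hgen (γ 0) (γ i) (γ (wordDist X a b))
    have h5 := wordDist_triangle hgen (γ i) (γ j) (γ (wordDist X a b))
    have h6 : wordDist X (γ 0) (γ (wordDist X a b)) = wordDist X a b := by rw [h0, hend]
    omega
  refine ⟨γ, ⟨h0, hend, fun i j hi hj => ?_⟩, hp⟩
  rcases le_total i j with hij | hij
  · rw [key i j hij hj, Nat.dist_eq_sub_of_le hij]
  · rw [wordDist_comm hgen, key j i hij hi, Nat.dist_eq_sub_of_le_right hij]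

lemma exists_isGeodesic (hgen : Subgroup.closure X = ⊤) (a b : G) :
    ∃ γ, IsGeodesic X a b γ := by
  obtain ⟨γ, hγ, -⟩ := exists_isGeodesic_through hgen (a := a) (p := a) (b := b)
    (by simp [wordDist, wordLength_one])
  exact ⟨γ, hγ⟩

/-- Every element has a prefix of each length up to its own. -/
lemma exists_prefix (hgen : Subgroup.closure X = ⊤) {g : G} {t : ℕ} (ht : t ≤ wordLength X g) :
    ∃ q, wordLength X q = t ∧ t + wordDist X q g = wordLength X g := by
  obtain ⟨γ, h0, h1, h⟩ := exists_isGeodesic hgen 1 g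
  rw [wordDist_one_left] at h1 h
  have e1 := h 0 t (Nat.zero_le _) ht
  have e2 := h t _ ht le_rfl
  rw [h0, wordDist_one_left, Nat.dist_eq_sub_of_le (Nat.zero_le _)] at e1
  rw [h1, Nat.dist_eq_sub_of_le ht] at e2
  exact ⟨γ t, by omega, by omega⟩

lemma finite_wordLength_le (hX : X.Finite) (hgen : Subgroup.closure X = ⊤) (n : ℕ) :
    {g : G | wordLength X g ≤ n}.Finite := by
  induction n with
  | zero =>
    refine (Set.finite_singleton (1 : G)).subset fun g hg => ?_
    exact eq_one_of_wordLength_eq_zero hgen (Nat.le_zero.1 hg)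
  | succ n ih =>
    have hY : {x : G | x ∈ X ∨ x⁻¹ ∈ X}.Finite := by
      refine (hX.union hX.inv).subset fun x hx => ?_
      simpa using hx
    refine (ih.union (Set.Finite.image2 (fun g x => g * x) ih hY)).subset fun g hg => ?_
    obtain ⟨w, hw, hwX, rfl⟩ := exists_word_length_eq hgen g
    rcases List.eq_nil_or_concat w with rfl | ⟨v, x, rfl⟩
    · left
      simp [wordLength_one]
    · right
      simp only [Set.mem_ofPred_eq] at hg
      simp only [List.concat_eq_append, List.length_append, List.length_singleton] at hw hwX ⊢
      refine ⟨v.prod, ?_, x, hwX x (by simp), by simp⟩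
      have := wordLength_prod_le (X := X) (w := v) fun y hy => hwX y (by simp [hy])
      simp only [List.concat_eq_append] at hg
      simp only [Set.mem_ofPred_eq]
      omega

end WordLength

/-! ### Level types in hyperbolic groups -/

section Hyperbolic

variable {G : Type*} [Group G] {X : Set G} {δ : ℕ}

/-- Points at the same level on geodesics from `1` to nearby endpoints are close. -/
lemma wordDist_le_of_thin (hgen : Subgroup.closure X = ⊤) (hδ : TrianglesThin X δ)
    {a b p q : G} (hpq : wordLength X p = wordLength X q)
    (hp : wordLength X p + wordDist X p a = wordLength X a)
    (hq : wordLength X q + wordDist X q b = wordLength X b)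
    (hfar : δ + wordDist X a b < wordDist X p a) :
    wordDist X p q ≤ 2 * δ := by
  simp only [← wordDist_one_left (X := X)] at hpq hp hq
  obtain ⟨γ₃, h₃, h₃p⟩ := exists_isGeodesic_through hgen hp
  obtain ⟨γ₁, h₁, h₁q⟩ := exists_isGeodesic_through hgen hq
  obtain ⟨γ₂, h₂⟩ := exists_isGeodesic hgen b a
  obtain ⟨j, ⟨hj, hd⟩ | ⟨hj, hd⟩⟩ := hδ 1 b a γ₁ γ₂ γ₃ h₁ h₂ h₃ (wordDist X 1 p) (by omega)
  · rw [h₃p] at hd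
    have e1 := h₁.2.2 0 j (Nat.zero_le _) hj
    have e2 := h₁.2.2 j (wordDist X 1 q) hj (by omega)
    rw [h₁.1, Nat.dist_eq_sub_of_le (Nat.zero_le _)] at e1
    rw [h₁q] at e2
    have t1 := wordDist_triangle hgen 1 p (γ₁ j)
    have t2 := wordDist_triangle hgen 1 (γ₁ j) p
    have t3 := wordDist_triangle hgen p (γ₁ j) q
    rw [wordDist_comm hgen (γ₁ j) p] at t2
    unfold Nat.dist at e2
    omega
  · rw [h₃p] at hd
    have e1 := h₂.2.2 j _ hj le_rfl
    rw [h₂.2.1, Nat.dist_eq_sub_of_le hj] at e1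
    have t1 := wordDist_triangle hgen p (γ₂ j) a
    rw [wordDist_comm hgen a b] at hfar
    omega

/-- The elements of the ball of radius `K` by which right multiplication does not increase the
length of `g`. -/
def levelType (X : Set G) (K : ℕ) (g : G) : Set G :=
  {h | wordLength X h ≤ K ∧ wordLength X (g * h) ≤ wordLength X g}

/-- The displacements from `g` to its ancestors `L` levels below. -/
def ancestorSet (X : Set G) (L : ℕ) (g : G) : Set G :=
  {v | wordLength X v = L ∧ wordLength X (g * v) + L = wordLength X g}

/-- If `q` is in the level type of `g₁`, the path from `1` to `g₁ * u` through `q` can be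
transplanted to `g₂`. -/
lemma wordLength_mul_le_of_levelType (hgen : Subgroup.closure X = ⊤) {K : ℕ} {g₁ g₂ u q : G}
    (hE : levelType X K g₁ ⊆ levelType X K g₂) (hq : wordLength X q ≤ wordLength X g₁)
    (hd : wordDist X g₁ q ≤ K) :
    wordLength X (g₂ * u) ≤ wordLength X g₂ + wordDist X q (g₁ * u) := by
  have hmem : g₁⁻¹ * q ∈ levelType X K g₂ := hE ⟨hd, by simpa using hq⟩
  have := wordLength_mul_le hgen (g₂ * (g₁⁻¹ * q)) (q⁻¹ * (g₁ * u))
  have e : g₂ * (g₁⁻¹ * q) * (q⁻¹ * (g₁ * u)) = g₂ * u := by group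
  rw [e] at this
  have h2 := hmem.2
  unfold wordDist
  omega

/-- The level type determines the cone type. -/
lemma cone_subset_of_levelType_eq (hgen : Subgroup.closure X = ⊤) (hδ : TrianglesThin X δ)
    {g₁ g₂ : G} (hE : levelType X (2 * δ + 3) g₁ = levelType X (2 * δ + 3) g₂) (n : ℕ) :
    ∀ u, wordLength X u = n → wordLength X (g₁ * u) = wordLength X g₁ + n →
      wordLength X (g₂ * u) = wordLength X g₂ + n := by
  induction n with
  | zero =>
    intro u hu _
    simp [eq_one_of_wordLength_eq_zero hgen hu]
  | succ n ih =>
    intro u hu h₁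
    obtain ⟨u', hu', hx⟩ := exists_prefix hgen (X := X) (g := u) (t := n) (by omega)
    have hd : ∀ g : G, wordDist X (g * u') (g * u) = 1 := fun g => by
      have : wordDist X (g * u') (g * u) = wordDist X u' u := by simp [wordDist, mul_assoc]
      omega
    have step : ∀ g : G, wordLength X (g * u) ≤ wordLength X (g * u') + 1 := fun g => by
      have := wordDist_triangle hgen 1 (g * u') (g * u)
      rw [hd, wordDist_one_left, wordDist_one_left] at this
      exact this
    have step' : wordLength X (g₂ * u') ≤ wordLength X (g₂ * u) + 1 := by
      have := wordDist_triangle hgen 1 (g₂ * u) (g₂ * u')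
      rw [wordDist_comm hgen (g₂ * u), hd, wordDist_one_left, wordDist_one_left] at this
      exact this
    have h₁' : wordLength X (g₁ * u') = wordLength X g₁ + n := by
      have := step g₁
      have := wordLength_mul_le hgen (X := X) g₁ u'
      omega
    have h₂' := ih u' hu' h₁'
    have hle := step g₂
    by_contra hne
    have hlt : wordLength X (g₂ * u) ≤ wordLength X g₂ + n := by omega
    by_cases hcase : wordLength X g₂ ≤ wordLength X (g₂ * u)
    · obtain ⟨q, hq, hqu⟩ := exists_prefix hgen hcase
      have hgu' : wordDist X g₂ (g₂ * u') = n := by rw [wordDist_self_mul, hu']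
      have hgq : wordDist X g₂ q ≤ 2 * δ + 3 := by
        by_cases hn : δ + 1 < n
        · have := wordDist_le_of_thin hgen hδ (a := g₂ * u') (b := g₂ * u) (p := g₂) (q := q)
            hq.symm (by omega) (by omega) (by rw [hd, hgu']; omega)
          omega
        · have t1 := wordDist_triangle hgen g₂ (g₂ * u') q
          have t2 := wordDist_triangle hgen (g₂ * u') (g₂ * u) q
          rw [hd, wordDist_comm hgen (g₂ * u) q] at t2
          omega
      have := wordLength_mul_le_of_levelType hgen (u := u) hE.symm.subset hq.le hgq
      omega
    · have hmem : u ∈ levelType X (2 * δ + 3) g₁ := by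
        rw [hE]
        exact ⟨by omega, by omega⟩
      have := hmem.2
      omega

/-- The level type of a descendant is determined by that of its ancestor. -/
lemma levelType_mul_subset (hgen : Subgroup.closure X = ⊤) (hδ : TrianglesThin X δ)
    {K L : ℕ} (hK : 2 * δ ≤ K) (hL : δ + K < L) {g₁ g₂ u : G}
    (hE : levelType X K g₁ ⊆ levelType X K g₂) (hu : wordLength X u = L)
    (h₁ : wordLength X (g₁ * u) = wordLength X g₁ + L)
    (h₂ : wordLength X (g₂ * u) = wordLength X g₂ + L) :
    levelType X K (g₁ * u) ⊆ levelType X K (g₂ * u) := by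
  rintro h ⟨hh, hle⟩
  refine ⟨hh, ?_⟩
  have hge : wordLength X g₁ ≤ wordLength X (g₁ * u * h) := by
    have := wordLength_mul_le hgen (X := X) (g₁ * u * h) h⁻¹
    rw [mul_inv_cancel_right, wordLength_inv hgen] at this
    omega
  obtain ⟨q, hq, hqh⟩ := exists_prefix hgen hge
  have hgu : wordDist X g₁ (g₁ * u) = L := by rw [wordDist_self_mul, hu]
  have := wordDist_le_of_thin hgen hδ (a := g₁ * u) (b := g₁ * u * h) (p := g₁) (q := q)
    hq.symm (by omega) (by omega) (by rw [hgu, wordDist_self_mul]; omega)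
  have := wordLength_mul_le_of_levelType hgen (u := u * h) hE hq.le (this.trans hK)
  rw [← mul_assoc, ← mul_assoc] at this
  omega

/-- The ancestors of a descendant of `g` are determined by the level type of `g`. -/
lemma ancestorSet_mul_subset (hgen : Subgroup.closure X = ⊤) (hδ : TrianglesThin X δ)
    {K L : ℕ} (hK : 2 * δ ≤ K) (hL : δ < L) {g₁ g₂ u : G}
    (hE : levelType X K g₁ ⊆ levelType X K g₂) (hu : wordLength X u = L)
    (h₁ : wordLength X (g₁ * u) = wordLength X g₁ + L)
    (h₂ : wordLength X (g₂ * u) = wordLength X g₂ + L) :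
    ancestorSet X L (g₁ * u) ⊆ ancestorSet X L (g₂ * u) := by
  rintro v ⟨hv, hvl⟩
  refine ⟨hv, ?_⟩
  have hgu : wordDist X g₁ (g₁ * u) = L := by rw [wordDist_self_mul, hu]
  have hvu : wordDist X (g₁ * u * v) (g₁ * u) = L := by
    rw [wordDist_comm hgen, wordDist_self_mul, hv]
  have hself := wordDist_self (X := X) (g₁ * u)
  have := wordDist_le_of_thin hgen hδ (a := g₁ * u) (b := g₁ * u) (p := g₁) (q := g₁ * u * v)
    (by omega) (by omega) (by omega) (by omega)
  have := wordLength_mul_le_of_levelType hgen (u := u * v) hE (q := g₁ * u * v) (by omega)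
    (this.trans hK)
  rw [← mul_assoc, ← mul_assoc, wordDist_self] at this
  have := wordLength_mul_le hgen (X := X) (g₂ * u * v) v⁻¹
  rw [mul_inv_cancel_right, wordLength_inv hgen] at this
  omega

end Hyperbolic

/-! ### Counting by types -/

/-- If finitely many types determine the types of the descendants `L` levels above, and the
displacements to the ancestors `L` levels below, then the growth series is rational. -/
lemma rational_growth_of_types {G τ : Type*} [Group G] [Finite τ] {X : Set G} (hX : X.Finite)
    (hgen : Subgroup.closure X = ⊤) (L : ℕ) (hL : 0 < L) (T : G → τ)
    (hsucc : ∀ g₁ g₂ u, T g₁ = T g₂ → wordLength X u = L →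
      wordLength X (g₁ * u) = wordLength X g₁ + L →
      wordLength X (g₂ * u) = wordLength X g₂ + L ∧ T (g₁ * u) = T (g₂ * u))
    (hanc : ∀ g₁ g₂, T g₁ = T g₂ → ancestorSet X L g₁ = ancestorSet X L g₂) :
    PowerSeriesIsRational (PowerSeries.mk fun n => (sphereCard X n : ℤ)) := by
  classical
  have := Fintype.ofFinite τ
  have hfin : ∀ n, {g : G | wordLength X g = n}.Finite := fun n =>
    (finite_wordLength_le hX hgen n).subset fun g hg => le_of_eq hg
  let S : ℕ → Finset G := fun n => (hfin n).toFinset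
  have hS : ∀ {n g}, g ∈ S n ↔ wordLength X g = n := by simp [S]
  let b : ℕ → τ → ℚ := fun n l => ((S n).filter fun g => T g = l).card
  let succ : G → τ → Finset G := fun g l =>
    (S L).filter fun u => wordLength X (g * u) = wordLength X g + L ∧ T (g * u) = l
  let anc : G → Finset G := fun g =>
    (S L).filter fun v => wordLength X (g * v) + L = wordLength X g
  have hsucc' : ∀ g₁ g₂ l, T g₁ = T g₂ → succ g₁ l = succ g₂ l := by
    have : ∀ g₁ g₂ l, T g₁ = T g₂ → succ g₁ l ⊆ succ g₂ l := by
      intro g₁ g₂ l h u hu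
      simp only [succ, Finset.mem_filter, hS] at hu ⊢
      obtain ⟨h1, h2⟩ := hsucc g₁ g₂ u h hu.1 hu.2.1
      exact ⟨hu.1, h1, h2 ▸ hu.2.2⟩
    exact fun g₁ g₂ l h => (this _ _ _ h).antisymm (this _ _ _ h.symm)
  have hanc' : ∀ g₁ g₂, T g₁ = T g₂ → anc g₁ = anc g₂ := by
    intro g₁ g₂ h
    ext v
    have := Set.ext_iff.1 (hanc g₁ g₂ h) v
    simpa only [anc, ancestorSet, Finset.mem_filter, hS, Set.mem_ofPred_eq] using this
  have hrep : ∀ g : G, T (Function.invFun T (T g)) = T g := fun g =>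
    Function.invFun_eq ⟨g, rfl⟩
  let M : τ → τ → ℕ := fun k l => (succ (Function.invFun T k) l).card
  let p : τ → ℕ := fun l => (anc (Function.invFun T l)).card
  have hcount : ∀ n l, p l * ((S (n + L)).filter fun g => T g = l).card =
      ∑ k, M k l * ((S n).filter fun g => T g = k).card := by
    intro n l
    have hl : p l * ((S (n + L)).filter fun g => T g = l).card =
        (((S (n + L)).filter fun g => T g = l).sigma fun g => anc g).card := by
      rw [Finset.card_sigma, mul_comm, ← smul_eq_mul, ← Finset.sum_const]
      refine Finset.sum_congr rfl fun g hg => ?_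
      rw [← (Finset.mem_filter.1 hg).2, hanc' g _ (hrep g).symm]
    have hr : ∑ k, M k l * ((S n).filter fun g => T g = k).card =
        ((S n).sigma fun g => succ g l).card := by
      rw [Finset.card_sigma, ← Finset.sum_fiberwise (S n) T]
      refine Finset.sum_congr rfl fun k _ => ?_
      rw [mul_comm, ← smul_eq_mul, ← Finset.sum_const]
      refine Finset.sum_congr rfl fun g hg => ?_
      rw [← (Finset.mem_filter.1 hg).2, hsucc' g _ l (hrep g).symm]
    rw [hl, hr]
    refine Finset.card_bij' (fun x _ => ⟨x.1 * x.2, x.2⁻¹⟩) (fun x _ => ⟨x.1 * x.2, x.2⁻¹⟩)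
      ?_ ?_ ?_ ?_
    · rintro ⟨g, v⟩ hx
      simp only [Finset.mem_sigma, Finset.mem_filter, hS, anc, succ, mul_inv_cancel_right,
        wordLength_inv hgen] at hx ⊢
      obtain ⟨⟨h1, h2⟩, h3, h4⟩ := hx
      exact ⟨by omega, h3, by omega, h2⟩
    · rintro ⟨g, u⟩ hx
      simp only [Finset.mem_sigma, Finset.mem_filter, hS, anc, succ, mul_inv_cancel_right,
        wordLength_inv hgen] at hx ⊢
      obtain ⟨h1, h2, h3, h4⟩ := hx
      exact ⟨⟨by omega, h4⟩, h2, by omega⟩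
    · rintro ⟨g, v⟩ _
      simp
    · rintro ⟨g, v⟩ _
      simp
  have hpos : ∀ n l, p l = 0 → ((S (n + L)).filter fun g => T g = l).card = 0 := by
    intro n l hp
    rw [Finset.card_eq_zero, Finset.filter_eq_empty_iff]
    rintro g hg rfl
    rw [hS] at hg
    obtain ⟨q, hq, hqg⟩ := exists_prefix hgen (X := X) (g := g) (t := n) (by omega)
    have hmem : g⁻¹ * q ∈ anc g := by
      simp only [anc, Finset.mem_filter, hS, mul_inv_cancel_left]
      rw [wordDist_comm hgen, wordDist] at hqg
      omega
    rw [hanc' g _ (hrep g).symm, Finset.card_eq_zero.1 hp] at hmem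
    simp at hmem
  refine powerSeriesIsRational_of_matrix (Matrix.of fun l k => (M k l : ℚ) / p l) b _ L hL
    (fun n => ?_) (fun n => ?_)
  · funext l
    simp only [Matrix.mulVec, dotProduct, Matrix.of_apply, b]
    by_cases hp : p l = 0
    · simp [hp, hpos n l hp]
    · have hp' : (p l : ℚ) ≠ 0 := by exact_mod_cast hp
      have hc : (p l : ℚ) * ((S (n + L)).filter fun g => T g = l).card =
        ∑ k, (M k l : ℚ) * ((S n).filter fun g => T g = k).card := by exact_mod_cast hcount n l
      refine mul_left_cancel₀ hp' ?_
      rw [hc, Finset.mul_sum]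
      refine Finset.sum_congr rfl fun k _ => ?_
      field_simp
  · have : sphereCard X n = (S n).card := Set.ncard_eq_toFinset_card _ (hfin n)
    simp only [this, b]
    exact_mod_cast Finset.card_eq_sum_card_fiberwise (f := T) (t := Finset.univ) (by simp)

/-- **Cannon's theorem.** A word-hyperbolic group has rational spherical growth series with
respect to any finite generating set. -/
theorem cannon_rational_growth {G : Type*} [Group G] (X : Finset G)
    (hgen : Subgroup.closure (X : Set G) = ⊤)
    (hhyp : ∃ δ : ℕ, 1 ≤ δ ∧ TrianglesThin (X : Set G) δ) :
    PowerSeriesIsRational (PowerSeries.mk fun n => (sphereCard (X : Set G) n : ℤ)) := by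
  obtain ⟨δ, -, hδ⟩ := hhyp
  set K := 2 * δ + 3 with hK
  set L := δ + K + 1 with hL
  let T : G → Set G × Set G := fun g => (levelType (X : Set G) K g, ancestorSet (X : Set G) L g)
  have hfin : (Set.range T).Finite := by
    have hball := finite_wordLength_le X.finite_toSet hgen
    refine ((hball K).finite_subsets.prod (hball L).finite_subsets).subset ?_
    rintro _ ⟨g, rfl⟩
    exact ⟨fun h hh => hh.1, fun h hh => hh.1.le⟩
  have := hfin.to_subtype
  refine rational_growth_of_types X.finite_toSet hgen L (by omega) (Set.rangeFactorization T)
    ?_ ?_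
  · intro g₁ g₂ u hT hu h₁
    have hE : levelType (X : Set G) K g₁ = levelType (X : Set G) K g₂ :=
      congrArg Prod.fst (Subtype.ext_iff.1 hT)
    have h₂ := cone_subset_of_levelType_eq hgen hδ hE L u hu h₁
    refine ⟨h₂, Subtype.ext (Prod.ext ?_ ?_)⟩
    · exact (levelType_mul_subset hgen hδ (by omega) (by omega) hE.subset hu h₁ h₂).antisymm
        (levelType_mul_subset hgen hδ (by omega) (by omega) hE.symm.subset hu h₂ h₁)
    · exact (ancestorSet_mul_subset hgen hδ (by omega) (by omega) hE.subset hu h₁ h₂).antisymm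
        (ancestorSet_mul_subset hgen hδ (by omega) (by omega) hE.symm.subset hu h₂ h₁)
  · exact fun g₁ g₂ hT => congrArg Prod.snd (Subtype.ext_iff.1 hT)
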